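/- arXiv:2107.06042 — 2 statements merged into one kernel-verified Lean document; each statement's English description precedes it below -/
import Mathlib

section
/- If Z is a dependence bisimulation between dependence models M and M' with (s,s') ∈ Z, then for every finite set X of variables and variable y: s ⊨ D_X y if and only if s' ⊨ D_X y. -/
/-- Syntax of the logic of functional dependence LFD over variables `V` and
relational vocabulary `P` with arity map `ar`. -/
inductive LFD (V P : Type) (ar : P → ℕ) : Type
  | atom : (p : P) → (Fin (ar p) → V) → LFD V P ar
  | neg : LFD V P ar → LFD V P ar
  | and : LFD V P ar → LFD V P ar → LFD V P ar
  | dmod : Finset V → LFD V P ar → LFD V P ar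
  | dep : Finset V → V → LFD V P ar

/-- A dependence model: a relational first-order structure together with a team. -/
structure DepModel (V P : Type) (ar : P → ℕ) : Type 1 where
  O : Type
  I : (p : P) → (Fin (ar p) → O) → Prop
  A : Set (V → O)

variable {V P : Type} {ar : P → ℕ}

/-- `agree s t X`: the assignments `s` and `t` agree on all variables in `X`. -/
def agree {O : Type} (s t : V → O) (X : Set V) : Prop := ∀ v ∈ X, s v = t v

/-- Truth of an LFD formula in a dependence model at an assignment. -/
def DepModel.sat (M : DepModel V P ar) : (V → M.O) → LFD V P ar → Prop
  | s, .atom p x => M.I p fun i => s (x i)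
  | s, .neg φ => ¬ M.sat s φ
  | s, .and φ ψ => M.sat s φ ∧ M.sat s ψ
  | s, .dmod X φ => ∀ t ∈ M.A, agree s t (X : Set V) → M.sat t φ
  | s, .dep X y => ∀ t ∈ M.A, agree s t (X : Set V) → s y = t y

/-- Semantic local dependence of `y` on a (possibly infinite) set `X` at `s`. -/
def locDep (M : DepModel V P ar) (s : V → M.O) (X : Set V) (y : V) : Prop :=
  ∀ t ∈ M.A, agree s t X → s y = t y

/-- Dependence bisimulation between dependence models. -/
structure IsDepBisim (M M' : DepModel V P ar)
    (Z : (V → M.O) → (V → M'.O) → Prop) : Prop where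
  nonempty : ∃ s s', Z s s'
  mem : ∀ {s s'}, Z s s' → s ∈ M.A ∧ s' ∈ M'.A
  ah : ∀ {s s'}, Z s s' → ∀ (p : P) (x : Fin (ar p) → V),
      (M.I p fun i => s (x i)) ↔ (M'.I p fun i => s' (x i))
  forth_closed : ∀ {s s'}, Z s s' → ∀ t ∈ M.A,
      ∀ y, locDep M' s' {v | s v = t v} y → s y = t y
  forth : ∀ {s s'}, Z s s' → ∀ t ∈ M.A,
      ∃ t' ∈ M'.A, Z t t' ∧ ∀ v, s v = t v → s' v = t' v
  back_closed : ∀ {s s'}, Z s s' → ∀ t' ∈ M'.A,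
      ∀ y, locDep M s {v | s' v = t' v} y → s' y = t' y
  back : ∀ {s s'}, Z s s' → ∀ t' ∈ M'.A,
      ∃ t ∈ M.A, Z t t' ∧ ∀ v, s' v = t' v → s v = t v

/-- dependence atoms are invariant under dependence bisimulations. -/
theorem dep_atoms_invariant_under_dep_bisim (M M' : DepModel V P ar)
    (Z : (V → M.O) → (V → M'.O) → Prop) (hZ : IsDepBisim M M' Z)
    {s : V → M.O} {s' : V → M'.O} (h : Z s s') :
    ∀ (X : Finset V) (y : V),
      M.sat s (LFD.dep X y) ↔ M'.sat s' (LFD.dep X y) := by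
  intro X y
  simp only [DepModel.sat]
  constructor
  · intro hdep t' ht' hagree
    exact hZ.back_closed h t' ht' y fun t ht hst =>
      hdep t ht fun v hv => hst v (hagree v hv)
  · intro hdep t ht hagree
    exact hZ.forth_closed h t ht y fun t' ht' hst =>
      hdep t' ht' fun v hv => hst v (hagree v hv)
end

section
/- Finite model property for LFD: every satisfiable LFD formula is satisfiable in a finite dependence model, i.e., a dependence model (M,A) with both the domain of M and the team A finite. -/
variable {V P : Type} {ar : P → ℕ}

/-- A directed multigraph with edges labelled by sets of variables and vertices labelled by
types. -/
structure LGraph (V T : Type) : Type 1 where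
  W : Type
  E : Type
  src : E → W
  tgt : E → W
  lab : E → Set V
  typ : W → T

namespace LGraph

section Basic

variable {T : Type} (G : LGraph V T)

/-- Vertices joined by an undirected path all of whose edge labels contain `X`. -/
def Conn (X : Set V) : G.W → G.W → Prop :=
  Relation.EqvGen fun a b => ∃ e, X ⊆ G.lab e ∧ G.src e = a ∧ G.tgt e = b

/-- Connectedness for `X` follows from connectedness for each single element of `X`. -/
def Exact (X : Set V) : Prop :=
  ∀ w w', (∀ x ∈ X, G.Conn {x} w w') → G.Conn X w w'

/-- Edges carrying `X` in the `X`-component of `w`. -/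
def edgesAt (X : Set V) (w : G.W) : Set G.E := {e | X ⊆ G.lab e ∧ G.Conn X w (G.src e)}

/-- The boundary of chains with coefficients modulo `2`. -/
noncomputable def bdry : (G.E →₀ ZMod 2) →ₗ[ZMod 2] (G.W →₀ ZMod 2) :=
  Finsupp.linearCombination _ fun e => Finsupp.single (G.src e) 1 + Finsupp.single (G.tgt e) 1

/-- The covering graph whose fibres are chains modulo `N`; traversing an edge adds its class. -/
noncomputable def cover (N : Submodule (ZMod 2) (G.E →₀ ZMod 2)) : LGraph V T where
  W := G.W × ((G.E →₀ ZMod 2) ⧸ N)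
  E := G.E × ((G.E →₀ ZMod 2) ⧸ N)
  src e := (G.src e.1, e.2)
  tgt e := (G.tgt e.1, e.2 + N.mkQ (Finsupp.single e.1 1))
  lab e := G.lab e.1
  typ w := G.typ w.1

/-- Cycles all of whose edges carry `X`. -/
noncomputable def cycles (X : Set V) : Submodule (ZMod 2) (G.E →₀ ZMod 2) :=
  Finsupp.supported (ZMod 2) (ZMod 2) {e | X ⊆ G.lab e} ⊓ LinearMap.ker G.bdry

variable {G} {X Y : Set V} {N : Submodule (ZMod 2) (G.E →₀ ZMod 2)}

theorem Conn.refl (w : G.W) : G.Conn X w w := Relation.EqvGen.refl w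

theorem Conn.symm {w z : G.W} (h : G.Conn X w z) : G.Conn X z w := Relation.EqvGen.symm _ _ h

theorem Conn.trans {u w z : G.W} (h : G.Conn X u w) (h' : G.Conn X w z) : G.Conn X u z :=
  Relation.EqvGen.trans _ _ _ h h'

theorem conn_edge {e : G.E} (h : X ⊆ G.lab e) : G.Conn X (G.src e) (G.tgt e) :=
  Relation.EqvGen.rel _ _ ⟨e, h, rfl, rfl⟩

theorem Conn.mono (hXY : Y ⊆ X) {w z : G.W} (h : G.Conn X w z) : G.Conn Y w z := by
  induction h with
  | rel a b h => obtain ⟨e, he, rfl, rfl⟩ := h; exact conn_edge (hXY.trans he)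
  | refl => exact .refl _
  | symm _ _ _ ih => exact ih.symm
  | trans _ _ _ _ _ ih ih' => exact ih.trans ih'

theorem Conn.single {x : V} (hx : x ∈ X) {w z : G.W} (h : G.Conn X w z) : G.Conn {x} w z :=
  h.mono (Set.singleton_subset_iff.2 hx)

/-- A function that is constant along edges carrying `X` is constant on `X`-components. -/
theorem Conn.apply_eq {α : Type*} (f : G.W → α)
    (hf : ∀ e, X ⊆ G.lab e → f (G.src e) = f (G.tgt e)) {w z : G.W} (h : G.Conn X w z) :
    f w = f z := by
  induction h with
  | rel a b h => obtain ⟨e, he, rfl, rfl⟩ := h; exact hf e he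
  | refl => rfl
  | symm _ _ _ ih => exact ih.symm
  | trans _ _ _ _ _ ih ih' => exact ih.trans ih'

theorem edgesAt_congr {w z : G.W} (h : G.Conn X w z) : G.edgesAt X w = G.edgesAt X z := by
  ext e
  exact and_congr_right fun _ => ⟨h.symm.trans, h.trans⟩

@[simp] theorem bdry_single (e : G.E) :
    G.bdry (Finsupp.single e 1) = Finsupp.single (G.src e) 1 + Finsupp.single (G.tgt e) 1 := by
  simp [bdry]

theorem Conn.of_cover {p q : (G.cover N).W} (h : (G.cover N).Conn X p q) : G.Conn X p.1 q.1 := by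
  induction h with
  | rel a b h => obtain ⟨e, he, rfl, rfl⟩ := h; exact conn_edge (G := G) (e := e.1) he
  | refl => exact .refl _
  | symm _ _ _ ih => exact ih.symm
  | trans _ _ _ _ _ ih ih' => exact ih.trans ih'

/-- The chain of a path in a covering graph. -/
theorem Conn.exists_chain {p q : (G.cover N).W} (h : (G.cover N).Conn X p q) :
    ∃ c ∈ Finsupp.supported (ZMod 2) (ZMod 2) (G.edgesAt X p.1),
      G.bdry c = Finsupp.single p.1 1 + Finsupp.single q.1 1 ∧ q.2 = p.2 + N.mkQ c := by
  induction h with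
  | rel a b h =>
    obtain ⟨e, he, rfl, rfl⟩ := h
    exact ⟨Finsupp.single e.1 1, Finsupp.single_mem_supported _ _ ⟨he, .refl _⟩,
      bdry_single _, rfl⟩
  | refl a => exact ⟨0, zero_mem _, by simp [ZModModule.add_self], by simp⟩
  | symm a b h ih =>
    obtain ⟨c, hc, hb, hq⟩ := ih
    refine ⟨c, edgesAt_congr (Conn.of_cover h) ▸ hc, by rw [hb, add_comm], ?_⟩
    rw [hq, add_assoc, ZModModule.add_self, add_zero]
  | trans a b d h _ ih ih' =>
    obtain ⟨c, hc, hb, hq⟩ := ih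
    obtain ⟨c', hc', hb', hq'⟩ := ih'
    refine ⟨c + c', add_mem hc (edgesAt_congr (Conn.of_cover h) ▸ hc'), ?_, ?_⟩
    · rw [map_add, hb, hb', add_add_add_comm, add_assoc, ← add_assoc (Finsupp.single b.1 1),
        ZModModule.add_self, zero_add]
    · rw [hq', hq, map_add, add_assoc]

/-- Paths lift to covering graphs, uniformly in the starting point. -/
theorem Conn.exists_lift (N : Submodule (ZMod 2) (G.E →₀ ZMod 2)) {w z : G.W}
    (h : G.Conn X w z) :
    ∃ c ∈ Finsupp.supported (ZMod 2) (ZMod 2) (G.edgesAt X w),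
      G.bdry c = Finsupp.single w 1 + Finsupp.single z 1 ∧
      ∀ a, (G.cover N).Conn X (w, a) (z, a + N.mkQ c) := by
  induction h with
  | rel a b h =>
    obtain ⟨e, he, rfl, rfl⟩ := h
    exact ⟨Finsupp.single e 1, Finsupp.single_mem_supported _ _ ⟨he, .refl _⟩,
      bdry_single _, fun a => conn_edge (G := G.cover N) (e := (e, a)) he⟩
  | refl a => exact ⟨0, zero_mem _, by simp [ZModModule.add_self], fun a => by
      rw [map_zero, add_zero]; exact .refl _⟩
  | symm a b h ih =>
    obtain ⟨c, hc, hb, hq⟩ := ih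
    refine ⟨c, edgesAt_congr h ▸ hc, by rw [hb, add_comm], fun d => ?_⟩
    have := (hq (d + N.mkQ c)).symm
    rwa [add_assoc, ZModModule.add_self, add_zero] at this
  | trans a b d h _ ih ih' =>
    obtain ⟨c, hc, hb, hq⟩ := ih
    obtain ⟨c', hc', hb', hq'⟩ := ih'
    refine ⟨c + c', add_mem hc (edgesAt_congr h ▸ hc'), ?_, fun f => ?_⟩
    · rw [map_add, hb, hb', add_add_add_comm, add_assoc, ← add_assoc (Finsupp.single b 1),
        ZModModule.add_self, zero_add]
    · rw [map_add, ← add_assoc]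
      exact (hq f).trans (hq' _)

/-- A chain in one `X`-component with the boundary of a path is traversed, modulo any `N`, by
an actual path. -/
theorem Conn.cover_of_chain {w z : G.W} (h : G.Conn X w z) {c : G.E →₀ ZMod 2}
    (hc : c ∈ Finsupp.supported (ZMod 2) (ZMod 2) (G.edgesAt X w))
    (hb : G.bdry c = Finsupp.single w 1 + Finsupp.single z 1)
    (a : (G.E →₀ ZMod 2) ⧸ N) :
    (G.cover N).Conn X (w, a) (z, a + N.mkQ c) := by
  have hq : ∀ u, ∃ q : G.E →₀ ZMod 2,
      G.Conn X w u → ∀ a, (G.cover N).Conn X (w, a) (u, a + N.mkQ q) := by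
    intro u
    by_cases hu : G.Conn X w u
    · obtain ⟨q, -, -, hq⟩ := hu.exists_lift N
      exact ⟨q, fun _ => hq⟩
    · exact ⟨0, fun h => absurd h hu⟩
  choose q hq using hq
  let Q : (G.W →₀ ZMod 2) →ₗ[ZMod 2] (G.E →₀ ZMod 2) := Finsupp.linearCombination _ q
  have key : ∀ a, (G.cover N).Conn X (w, a) (w, a + N.mkQ (c + Q (G.bdry c))) := by
    rw [Finsupp.supported_eq_span_single] at hc
    clear hb
    induction hc using Submodule.span_induction with
    | mem c hc =>
      obtain ⟨e, ⟨he, hwe⟩, rfl⟩ := hc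
      intro a
      have h1 := hq _ hwe a
      have h2 := conn_edge (G := G.cover N) (e := (e, a + N.mkQ (q (G.src e)))) he
      have h3 := hq _ (hwe.trans (conn_edge he))
        (a + N.mkQ (Finsupp.single e 1 + Q (G.bdry (Finsupp.single e 1))))
      refine h1.trans (h2.trans ?_)
      convert h3.symm using 2
      simp only [cover, bdry_single, map_add, Q, Finsupp.linearCombination_single, one_smul]
      simp only [add_assoc, ZModModule.add_self, add_zero]
      abel_nf
    | zero => intro a; simpa using Conn.refl (G := G.cover N) (X := X) (w, a)
    | add c c' _ _ ih ih' =>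
      intro a
      convert (ih a).trans (ih' _) using 2
      simp only [map_add]
      abel_nf
    | smul r c _ ih =>
      obtain rfl | rfl : r = 0 ∨ r = 1 := by revert r; decide
      · intro a; simpa using Conn.refl (G := G.cover N) (X := X) (w, a)
      · rwa [one_smul]
  have h1 := (key a).trans ((hq w (.refl _) _).trans (hq z h _))
  convert h1 using 2
  rw [hb]
  simp only [map_add, Q, Finsupp.linearCombination_single, one_smul]
  have := ZModModule.add_self (N.mkQ (q w))
  have h' := ZModModule.add_self (N.mkQ (q z))
  rw [show a + (N.mkQ c + (N.mkQ (q w) + N.mkQ (q z))) + N.mkQ (q w) + N.mkQ (q z) =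
    a + N.mkQ c + (N.mkQ (q w) + N.mkQ (q w)) + (N.mkQ (q z) + N.mkQ (q z)) by abel, this, h',
    add_zero, add_zero]

theorem mkQ_eq_iff_add_mem {c d : G.E →₀ ZMod 2} : N.mkQ c = N.mkQ d ↔ c + d ∈ N := by
  rw [← ZModModule.sub_eq_add, Submodule.mkQ_apply, Submodule.mkQ_apply, Submodule.Quotient.eq]

theorem mapDomain_bdry_eq_zero {α : Type*} (f : G.W → α)
    (hf : ∀ e, X ⊆ G.lab e → f (G.src e) = f (G.tgt e)) {c : G.E →₀ ZMod 2}
    (hc : c ∈ Finsupp.supported (ZMod 2) (ZMod 2) {e | X ⊆ G.lab e}) :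
    Finsupp.lmapDomain (ZMod 2) (ZMod 2) f (G.bdry c) = 0 := by
  rw [Finsupp.supported_eq_span_single] at hc
  induction hc using Submodule.span_induction with
  | mem c hc =>
    obtain ⟨e, he, rfl⟩ := hc
    simp [hf e he, Finsupp.mapDomain_add, Finsupp.mapDomain_single, ZModModule.add_self]
  | zero => simp
  | add c d _ _ ih ih' => rw [map_add, map_add, ih, ih', add_zero]
  | smul r c _ ih => rw [map_smul, map_smul, ih, smul_zero]

/-- A chain of edges carrying `X` whose boundary consists of two points joins these points. -/
theorem conn_of_bdry {w z : G.W} {c : G.E →₀ ZMod 2}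
    (hc : c ∈ Finsupp.supported (ZMod 2) (ZMod 2) {e | X ⊆ G.lab e})
    (hb : G.bdry c = Finsupp.single w 1 + Finsupp.single z 1) : G.Conn X w z := by
  have h := mapDomain_bdry_eq_zero (fun u => {v | G.Conn X u v}) (fun e he => by
    ext v
    exact ⟨(conn_edge he).symm.trans, (conn_edge he).trans⟩) hc
  rw [hb, map_add, ← ZModModule.sub_eq_add, sub_eq_zero, Finsupp.lmapDomain_apply,
    Finsupp.lmapDomain_apply, Finsupp.mapDomain_single, Finsupp.mapDomain_single,
    Finsupp.single_left_inj one_ne_zero] at h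
  exact (Set.ext_iff.1 h z).2 (.refl z)

/-- The chains of a family of paths in the covering graph, one for each variable in `Y`. -/
theorem exists_chains {p q : (G.cover (G.cycles X)).W}
    (h : ∀ y ∈ Y, (G.cover (G.cycles X)).Conn {y} p q) :
    ∃ c : V → G.E →₀ ZMod 2,
      (∀ y ∈ Y, c y ∈ Finsupp.supported (ZMod 2) (ZMod 2) (G.edgesAt {y} p.1) ∧
        G.bdry (c y) = Finsupp.single p.1 1 + Finsupp.single q.1 1 ∧
        q.2 = p.2 + (G.cycles X).mkQ (c y)) ∧
      ∀ x ∈ Y, ∀ e, ¬ X ⊆ G.lab e → c x e ≠ 0 → ∀ y ∈ Y, e ∈ G.edgesAt {y} p.1 := by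
  choose! c hc hb hq using fun y hy => (h y hy).exists_chain
  refine ⟨c, fun y hy => ⟨hc y hy, hb y hy, hq y hy⟩, fun x hx e he hxe y hy => ?_⟩
  have h1 := mkQ_eq_iff_add_mem.1 (add_left_cancel ((hq x hx).symm.trans (hq y hy)))
  have h2 := (Finsupp.mem_supported' _ _).1 h1.1 e he
  rw [Finsupp.add_apply, ← ZModModule.sub_eq_add, sub_eq_zero] at h2
  by_contra h3
  exact hxe (h2.trans ((Finsupp.mem_supported' _ _).1 (hc y hy) e h3))

/-- Dividing out the cycles carrying `X` makes the graph exact at `X`. -/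
theorem exact_cover_cycles (hX : X.Nonempty) : (G.cover (G.cycles X)).Exact X := by
  intro p q h
  obtain ⟨x, hx⟩ := hX
  obtain ⟨c, hc, hce⟩ := exists_chains h
  obtain ⟨-, hb, hq⟩ := hc x hx
  have hs : c x ∈ Finsupp.supported (ZMod 2) (ZMod 2) {e | X ⊆ G.lab e} := by
    refine (Finsupp.mem_supported' _ _).2 fun e he => ?_
    by_contra h0
    exact he fun y hy => (hce x hx e he h0 y hy).1 rfl
  obtain ⟨d, hd, hdb, hdl⟩ := (conn_of_bdry hs hb).exists_lift (G.cycles X)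
  have hm : c x + d ∈ G.cycles X :=
    ⟨add_mem hs (Finsupp.supported_mono (fun e he => he.1) hd), by
      rw [SetLike.mem_coe, LinearMap.mem_ker, map_add, hb, hdb, ZModModule.add_self]⟩
  have := hdl p.2
  rwa [← mkQ_eq_iff_add_mem.2 hm, ← hq] at this

/-- Dividing out the cycles carrying `X` preserves exactness at `Y` when the graph is exact at
`X ∪ Y`. -/
theorem Exact.cover_cycles (hY : Y.Nonempty) (hGY : G.Exact Y) (hGXY : G.Exact (X ∪ Y)) :
    (G.cover (G.cycles X)).Exact Y := by
  classical
  intro p q h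
  obtain ⟨x, hx⟩ := hY
  obtain ⟨c, hc, hce⟩ := exists_chains h
  obtain ⟨-, hb, hq⟩ := hc x hx
  have hpq : G.Conn Y p.1 q.1 := hGY _ _ fun y hy => (h y hy).of_cover
  set a := (c x).filter fun e => ¬ X ⊆ G.lab e with ha_def
  set b := (c x).filter fun e => X ⊆ G.lab e with hb_def
  have hab : b + a = c x := Finsupp.filter_add_filter_not _ _
  have ha : a ∈ Finsupp.supported (ZMod 2) (ZMod 2) (G.edgesAt Y p.1) := by
    refine (Finsupp.mem_supported' _ _).2 fun e he => ?_
    by_contra h0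
    obtain ⟨h1, h2⟩ : ¬ X ⊆ G.lab e ∧ c x e ≠ 0 := by
      simpa [ha_def, Finsupp.filter_apply] using h0
    have h3 := hce x hx e h1 h2
    exact he ⟨fun y hy => (h3 y hy).1 rfl, hGY _ _ fun y hy => (h3 y hy).2⟩
  have hbX : b ∈ Finsupp.supported (ZMod 2) (ZMod 2) {e | X ⊆ G.lab e} :=
    (Finsupp.mem_supported' _ _).2 fun e he => Finsupp.filter_apply_neg _ _ he
  have hbS : G.bdry b ∈ Finsupp.supported (ZMod 2) (ZMod 2) {z | G.Conn Y p.1 z} := by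
    have h1 : G.bdry b = Finsupp.single p.1 1 + Finsupp.single q.1 1 + G.bdry a := by
      rw [← hb, ← hab, map_add, add_assoc, ZModModule.add_self, add_zero]
    rw [h1]
    refine add_mem (add_mem (Finsupp.single_mem_supported _ _ (.refl _))
      (Finsupp.single_mem_supported _ _ hpq)) ?_
    rw [Finsupp.supported_eq_span_single] at ha
    rw [← Submodule.mem_comap]
    refine Submodule.span_le.2 ?_ ha
    rintro _ ⟨e, he, rfl⟩
    simp only [Submodule.comap_coe, Set.mem_preimage, bdry_single]
    exact add_mem (Finsupp.single_mem_supported _ _ he.2)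
      (Finsupp.single_mem_supported _ _ (he.2.trans (conn_edge he.1)))
  let r : G.W → G.W := fun z => @Classical.epsilon _ ⟨p.1⟩ fun u => G.Conn X z u ∧ G.Conn Y p.1 u
  have hrX : ∀ e, X ⊆ G.lab e → r (G.src e) = r (G.tgt e) := fun e he => by
    have h1 : ∀ u, G.Conn X (G.src e) u ↔ G.Conn X (G.tgt e) u := fun u =>
      ⟨(conn_edge he).symm.trans, (conn_edge he).trans⟩
    simp only [r, h1]
  have hr : ∀ z, G.Conn Y p.1 z → G.Conn (X ∪ Y) z (r z) := fun z hz => by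
    have hex : ∃ u, G.Conn X z u ∧ G.Conn Y p.1 u := ⟨z, .refl _, hz⟩
    obtain ⟨h1, h2⟩ := Classical.epsilon_spec hex
    refine hGXY _ _ ?_
    rintro y (hy | hy)
    · exact h1.single hy
    · exact (hz.symm.trans h2).single hy
  have hd : ∀ z, ∃ d : G.E →₀ ZMod 2, G.Conn Y p.1 z →
      d ∈ Finsupp.supported (ZMod 2) (ZMod 2) (G.edgesAt (X ∪ Y) z) ∧
        G.bdry d = Finsupp.single z 1 + Finsupp.single (r z) 1 := fun z => by
    by_cases hz : G.Conn Y p.1 z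
    · obtain ⟨d, h1, h2, -⟩ := (hr z hz).exists_lift ⊥
      exact ⟨d, fun _ => ⟨h1, h2⟩⟩
    · exact ⟨0, fun h => absurd h hz⟩
  choose d hd using hd
  let D : (G.W →₀ ZMod 2) →ₗ[ZMod 2] (G.E →₀ ZMod 2) := Finsupp.linearCombination _ d
  have hD : ∀ f ∈ Finsupp.supported (ZMod 2) (ZMod 2) {z | G.Conn Y p.1 z},
      D f ∈ Finsupp.supported (ZMod 2) (ZMod 2) {e | X ⊆ G.lab e} ∧
      D f ∈ Finsupp.supported (ZMod 2) (ZMod 2) (G.edgesAt Y p.1) ∧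
      G.bdry (D f) = f + Finsupp.lmapDomain (ZMod 2) (ZMod 2) r f := by
    intro f hf
    rw [Finsupp.supported_eq_span_single] at hf
    induction hf using Submodule.span_induction with
    | mem f hf =>
      obtain ⟨z, hz, rfl⟩ := hf
      obtain ⟨h1, h2⟩ := hd z hz
      simp only [D, Finsupp.linearCombination_single, one_smul, Finsupp.lmapDomain_apply,
        Finsupp.mapDomain_single]
      refine ⟨Finsupp.supported_mono (fun e he => Set.subset_union_left.trans he.1) h1,
        Finsupp.supported_mono (t := G.edgesAt Y p.1) (fun e he =>
          ⟨Set.subset_union_right.trans he.1, hz.trans (he.2.mono Set.subset_union_right)⟩) h1, h2⟩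
    | zero => simp
    | add f g _ _ ih ih' =>
      refine ⟨?_, ?_, ?_⟩
      · rw [map_add]; exact add_mem ih.1 ih'.1
      · rw [map_add]; exact add_mem ih.2.1 ih'.2.1
      · rw [map_add, map_add, map_add, ih.2.2, ih'.2.2, add_add_add_comm]
    | smul k f _ ih =>
      refine ⟨?_, ?_, ?_⟩
      · rw [map_smul]; exact Submodule.smul_mem _ _ ih.1
      · rw [map_smul]; exact Submodule.smul_mem _ _ ih.2.1
      · rw [map_smul, map_smul, map_smul, ih.2.2, smul_add]
  obtain ⟨hD1, hD2, hD3⟩ := hD _ hbS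
  rw [mapDomain_bdry_eq_zero r hrX hbX, add_zero] at hD3
  have hm : c x + (D (G.bdry b) + a) ∈ G.cycles X := by
    rw [← hab, ← add_assoc, add_assoc b, add_comm a, ← add_assoc, add_assoc, ZModModule.add_self,
      add_zero]
    refine ⟨add_mem hbX hD1, ?_⟩
    rw [SetLike.mem_coe, LinearMap.mem_ker, map_add, hD3, ZModModule.add_self]
  have := hpq.cover_of_chain (N := G.cycles X) (add_mem hD2 ha)
    (by rw [map_add, hD3, ← map_add, hab, hb]) p.2
  rwa [← mkQ_eq_iff_add_mem.2 hm, ← hq] at this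

/-- The properties of a graph over a relation `B` between types that are preserved by covers. -/
structure Realizes (G : LGraph V T) (B : T → Set V → T → Prop) : Prop where
  finite_W : Finite G.W
  finite_E : Finite G.E
  typ_edge : ∀ e, B (G.typ (G.src e)) (G.lab e) (G.typ (G.tgt e))
  exists_edge : ∀ w Y t, B (G.typ w) Y t → ∃ e, G.lab e = Y ∧ G.src e = w ∧ G.typ (G.tgt e) = t
  not_conn : ∀ e, ∀ y ∉ G.lab e, ¬ G.Conn {y} (G.src e) (G.tgt e)
  typ_surjective : Function.Surjective G.typ

theorem finite_quotient [Finite G.E] : Finite ((G.E →₀ ZMod 2) ⧸ N) :=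
  have : Finite (G.E →₀ ZMod 2) :=
    Finite.of_injective (fun f => (f : G.E → ZMod 2)) DFunLike.coe_injective
  Finite.of_surjective _ N.mkQ_surjective

theorem Realizes.cover {B : T → Set V → T → Prop} (h : G.Realizes B)
    (N : Submodule (ZMod 2) (G.E →₀ ZMod 2)) : (G.cover N).Realizes B :=
  have := h.finite_W
  have := h.finite_E
  have := finite_quotient (N := N)
  { finite_W := inferInstanceAs (Finite (G.W × _))
    finite_E := inferInstanceAs (Finite (G.E × _))
    typ_edge := fun e => h.typ_edge e.1
    exists_edge := fun w Y t hB => by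
      obtain ⟨e, h1, h2, h3⟩ := h.exists_edge w.1 Y t hB
      exact ⟨(e, w.2), h1, Prod.ext h2 rfl, h3⟩
    not_conn := fun e y hy hc => h.not_conn e.1 y hy hc.of_cover
    typ_surjective := fun t => by
      obtain ⟨w, hw⟩ := h.typ_surjective t
      exact ⟨(w, 0), hw⟩ }

/-- The graph whose vertices are the types and whose edges are the instances of `B`. -/
def ofRel (B : T → Set V → T → Prop) : LGraph V T where
  W := T
  E := {p : T × Set V × T // B p.1 p.2.1 p.2.2}
  src p := p.1.1
  tgt p := p.1.2.2
  lab p := p.1.2.1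
  typ t := t

theorem realizes_cover_ofRel [Finite V] [Finite T] (B : T → Set V → T → Prop) :
    ((ofRel B).cover ⊥).Realizes B :=
  have : Finite (ofRel B).W := inferInstanceAs (Finite T)
  have : Finite (ofRel B).E :=
    inferInstanceAs (Finite {p : T × Set V × T // B p.1 p.2.1 p.2.2})
  have := finite_quotient (G := ofRel B) (N := ⊥)
  { finite_W := inferInstanceAs (Finite ((ofRel B).W × _))
    finite_E := inferInstanceAs (Finite ((ofRel B).E × _))
    typ_edge := fun e => e.1.2
    exists_edge := fun w Y t hB => ⟨(⟨(w.1, Y, t), hB⟩, w.2), rfl, rfl, rfl⟩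
    not_conn := fun e y hy hc => by
      obtain ⟨c, hc, -, hq⟩ := hc.exists_chain
      have h1 := mkQ_eq_iff_add_mem.1 (add_left_cancel hq)
      rw [Submodule.mem_bot, ← ZModModule.sub_eq_add, sub_eq_zero] at h1
      have h2 := (Finsupp.mem_supported' _ _).1 hc e.1 fun h => hy (h.1 rfl)
      rw [← h1] at h2
      simp at h2
    typ_surjective := fun t => ⟨(t, 0), rfl⟩ }

/-- Any finite relation between types is realized by a finite graph in which agreement on each
variable of a set implies connectedness for that set. -/
theorem exists_realizes_exact [Finite V] [Finite T] (B : T → Set V → T → Prop) :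
    ∃ G : LGraph V T, G.Realizes B ∧ ∀ X : Set V, X.Nonempty → G.Exact X := by
  classical
  suffices H : ∀ (n : ℕ) (Q : Finset (Set V)), Q.card = n →
      (∀ X ∈ Q, ∀ Y, X ⊆ Y → Y ∈ Q) →
      ∃ G : LGraph V T, G.Realizes B ∧ ∀ X ∈ Q, X.Nonempty → G.Exact X by
    have := Fintype.ofFinite (Set V)
    obtain ⟨G, h1, h2⟩ := H _ Finset.univ rfl fun _ _ _ _ => Finset.mem_univ _
    exact ⟨G, h1, fun X => h2 X (Finset.mem_univ _)⟩
  intro n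
  induction n with
  | zero =>
    intro Q hQ _
    rw [Finset.card_eq_zero] at hQ
    exact ⟨_, realizes_cover_ofRel B, by simp [hQ]⟩
  | succ n ih =>
    intro Q hQ hup
    obtain ⟨X, hX⟩ := Q.exists_minimal (Finset.card_pos.1 (by omega))
    have hmem : ∀ {Y Z}, Y ∈ Q → Y ≠ X → Y ⊆ Z → Z ∈ Q.erase X := fun {Y Z} hY hYX hYZ =>
      Finset.mem_erase.2 ⟨fun h => hYX ((h ▸ hYZ).antisymm (hX.2 hY (h ▸ hYZ))), hup Y hY Z hYZ⟩
    obtain ⟨G, hG, hGQ⟩ := ih (Q.erase X) (by rw [Finset.card_erase_of_mem hX.1]; omega)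
      fun Y hY Z => hmem (Finset.mem_of_mem_erase hY) (Finset.ne_of_mem_erase hY)
    refine ⟨_, hG.cover (G.cycles X), fun Y hY hYn => ?_⟩
    obtain rfl | hYX := eq_or_ne Y X
    · exact exact_cover_cycles hYn
    · exact .cover_cycles hYn (hGQ _ (hmem hY hYX subset_rfl) hYn)
        (hGQ _ (hmem hY hYX Set.subset_union_right) hYn.inr)

end Basic

end LGraph

/-- The subformulas of a formula. -/
def LFD.subformulas : LFD V P ar → Set (LFD V P ar)
  | .atom p x => {.atom p x}
  | .neg φ => insert (.neg φ) φ.subformulas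
  | .and φ ψ => insert (.and φ ψ) (φ.subformulas ∪ ψ.subformulas)
  | .dmod X φ => insert (.dmod X φ) φ.subformulas
  | .dep X y => {.dep X y}

theorem LFD.mem_subformulas_self (φ : LFD V P ar) : φ ∈ φ.subformulas := by
  cases φ <;> simp [subformulas]

theorem LFD.finite_subformulas (φ : LFD V P ar) : φ.subformulas.Finite := by
  induction φ with
  | atom => exact Set.finite_singleton _
  | neg _ ih => exact ih.insert _
  | and _ _ ih ih' => exact (ih.union ih').insert _
  | dmod _ _ ih => exact ih.insert _
  | dep => exact Set.finite_singleton _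

theorem agree.symm {O : Type} {s t : V → O} {X : Set V} (h : agree s t X) : agree t s X :=
  fun v hv => (h v hv).symm

theorem agree.trans {O : Type} {s t u : V → O} {X : Set V} (h : agree s t X)
    (h' : agree t u X) : agree s u X :=
  fun v hv => (h v hv).trans (h' v hv)

theorem agree.mono {O : Type} {s t : V → O} {X Y : Set V} (hXY : X ⊆ Y) (h : agree s t Y) :
    agree s t X :=
  fun v hv => h v (hXY hv)

namespace DepModel

variable (M : DepModel V P ar) (C : Set (LFD V P ar))

/-- The truth of `φ` only depends on the values of the variables in `X`. -/
def LocalOn (X : Set V) (φ : LFD V P ar) : Prop :=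
  ∀ s ∈ M.A, ∀ t ∈ M.A, agree s t X → M.sat s φ → M.sat t φ

theorem localOn_atom (p : P) (x : Fin (ar p) → V) : M.LocalOn (Set.range x) (.atom p x) := by
  intro s _ t _ h hs
  rw [sat] at hs ⊢
  rwa [← show (fun i => s (x i)) = fun i => t (x i) from funext fun i => h _ ⟨i, rfl⟩]

theorem localOn_dmod (X : Finset V) (φ : LFD V P ar) : M.LocalOn X (.dmod X φ) := by
  intro s _ t _ h hs
  rw [sat] at hs ⊢
  exact fun u hu htu => hs u hu (h.trans htu)

theorem localOn_dep (X : Finset V) (y : V) : M.LocalOn X (.dep X y) := by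
  intro s _ t ht h hs
  rw [sat] at hs ⊢
  exact fun u hu htu => (hs t ht h).symm.trans (hs u hu (h.trans htu))

/-- The formulas of `C` true at `s`. -/
def type (s : V → M.O) : Set (LFD V P ar) := {φ ∈ C | M.sat s φ}

/-- The types realized in the team. -/
abbrev Types : Type := {t : Set (LFD V P ar) // ∃ s ∈ M.A, t = M.type C s}

/-- Two types are realized by assignments that agree on the dependence-closed set `Y`. -/
def Step (t : M.Types C) (Y : Set V) (t' : M.Types C) : Prop :=
  ∃ s ∈ M.A, ∃ s' ∈ M.A, t.1 = M.type C s ∧ t'.1 = M.type C s' ∧ agree s s' Y ∧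
    ∀ y, locDep M s Y y → y ∈ Y

variable {M C}

theorem finite_types (hC : C.Finite) : Finite (M.Types C) := by
  refine (hC.finite_subsets.subset ?_ : {t | ∃ s ∈ M.A, t = M.type C s}.Finite).to_subtype
  rintro _ ⟨s, -, rfl⟩ φ hφ
  exact hφ.1

/-- The closure of `X` under dependence gives a step to each assignment agreeing on `X`. -/
theorem step_closure {s s' : V → M.O} (hs : s ∈ M.A) (hs' : s' ∈ M.A) {X : Set V}
    (h : agree s s' X) :
    M.Step C ⟨_, s, hs, rfl⟩ {y | locDep M s X y} ⟨_, s', hs', rfl⟩ :=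
  ⟨s, hs, s', hs', rfl, rfl, fun _ hy => hy s' hs' h,
    fun _ hy t ht hst => hy t ht fun _ hz => hz t ht hst⟩

end DepModel

namespace LGraph

/-- The assignment of a vertex, sending a variable to its component. -/
def assign {T : Type} (G : LGraph V T) (w : G.W) (x : V) : V × Set G.W :=
  (x, {z | G.Conn {x} w z})

/-- The dependence model on the component of `w₀` in a graph of types. -/
abbrev model {T : Type} (G : LGraph V T) (τ : T → Set (LFD V P ar)) (w₀ : G.W) :
    DepModel V P ar where
  O := V × Set G.W
  I p a := ∃ w x, G.Conn ∅ w₀ w ∧ .atom p x ∈ τ (G.typ w) ∧ a = fun i => G.assign w (x i)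
  A := {f | ∃ w, G.Conn ∅ w₀ w ∧ f = G.assign w}

theorem assign_eq_iff {T : Type} {G : LGraph V T} {w z : G.W} {x y : V} :
    G.assign w x = G.assign z y ↔ x = y ∧ G.Conn {x} w z := by
  constructor
  · intro h
    obtain ⟨rfl, h2⟩ := Prod.mk.inj h
    exact ⟨rfl, (Set.ext_iff.1 h2 z).2 (.refl z)⟩
  · rintro ⟨rfl, h⟩
    exact Prod.ext rfl (Set.ext fun u => ⟨h.symm.trans, h.trans⟩)

theorem agree_assign_iff {T : Type} {G : LGraph V T}
    (hG : ∀ X : Set V, X.Nonempty → G.Exact X) {w z : G.W} (h : G.Conn ∅ w z) {X : Set V} :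
    agree (G.assign w) (G.assign z) X ↔ G.Conn X w z := by
  constructor
  · intro ha
    obtain rfl | hX := X.eq_empty_or_nonempty
    · exact h
    · exact hG X hX _ _ fun x hx => (assign_eq_iff.1 (ha x hx)).2
  · exact fun hc x hx => assign_eq_iff.2 ⟨rfl, hc.single hx⟩

section Truth

variable {M : DepModel V P ar} {C : Set (LFD V P ar)} {G : LGraph V (M.Types C)}

theorem Conn.mem_typ_iff (hG : G.Realizes (M.Step C)) {X : Set V} {φ : LFD V P ar}
    (hφ : M.LocalOn X φ) {w z : G.W} (h : G.Conn X w z) :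
    φ ∈ (G.typ w).1 ↔ φ ∈ (G.typ z).1 := by
  refine (h.apply_eq (fun w => φ ∈ (G.typ w).1) fun e he => propext ?_).to_iff
  obtain ⟨s, hs, s', hs', h1, h2, ha, -⟩ := hG.typ_edge e
  rw [h1, h2]
  exact and_congr_right fun _ =>
    ⟨hφ s hs s' hs' (ha.mono he), hφ s' hs' s hs (ha.mono he).symm⟩

theorem Conn.of_dep_mem_typ (hG : G.Realizes (M.Step C)) {X : Finset V} {y : V} {w z : G.W}
    (h : G.Conn X w z) (hw : .dep X y ∈ (G.typ w).1) : G.Conn {y} w z := by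
  induction h with
  | rel a b h =>
    obtain ⟨e, he, rfl, rfl⟩ := h
    obtain ⟨s, hs, s', hs', h1, -, -, hcl⟩ := hG.typ_edge e
    rw [h1] at hw
    have hd := hw.2
    rw [DepModel.sat] at hd
    exact conn_edge (Set.singleton_subset_iff.2
      (hcl y fun t ht hst => hd t ht (hst.mono he)))
  | refl => exact .refl _
  | symm a b h ih => exact (ih ((Conn.mem_typ_iff hG (M.localOn_dep X y) h).2 hw)).symm
  | trans a b c h _ ih ih' =>
    exact (ih hw).trans (ih' ((Conn.mem_typ_iff hG (M.localOn_dep X y) h).1 hw))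

theorem exists_conn_typ_eq (hG : G.Realizes (M.Step C)) {w : G.W} {s s' : V → M.O}
    (hs : s ∈ M.A) (hs' : s' ∈ M.A) (hw : (G.typ w).1 = M.type C s) {X : Set V}
    (h : agree s s' X) :
    ∃ z, G.Conn X w z ∧ (G.typ z).1 = M.type C s' ∧ ∀ y, ¬ locDep M s X y → ¬ G.Conn {y} w z := by
  have hB : M.Step C (G.typ w) {y | locDep M s X y} ⟨_, s', hs', rfl⟩ := by
    rw [show G.typ w = ⟨_, s, hs, rfl⟩ from Subtype.ext hw]
    exact DepModel.step_closure hs hs' h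
  obtain ⟨e, hl, rfl, ht⟩ := hG.exists_edge _ _ _ hB
  refine ⟨_, conn_edge ?_, congrArg Subtype.val ht, fun y hy => hG.not_conn e y ?_⟩
  · rw [hl]
    exact fun x hx t _ ht => ht x hx
  · rwa [hl]

/-- The truth lemma: the formulas of `C` true at the assignment of a vertex are those in its
type. -/
theorem sat_model_iff (hG : G.Realizes (M.Step C))
    (hex : ∀ X : Set V, X.Nonempty → G.Exact X) (w₀ : G.W) (φ : LFD V P ar)
    (hφ : φ.subformulas ⊆ C) {w : G.W} (hw : G.Conn ∅ w₀ w) :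
    (G.model Subtype.val w₀).sat (G.assign w) φ ↔ φ ∈ (G.typ w).1 := by
  have hC := hφ φ.mem_subformulas_self
  obtain ⟨s, hs, hws⟩ := (G.typ w).2
  induction φ generalizing w s with
  | atom p x =>
    rw [DepModel.sat]
    constructor
    · rintro ⟨z, x', hz, hm, he⟩
      have h i := assign_eq_iff.1 (congrFun he i)
      obtain rfl : x = x' := funext fun i => (h i).1
      refine (Conn.mem_typ_iff hG (M.localOn_atom p x) ?_).2 hm
      refine (agree_assign_iff hex (hw.symm.trans hz)).1 ?_
      rintro _ ⟨i, rfl⟩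
      exact congrFun he i
    · exact fun h => ⟨w, x, hw, h, rfl⟩
  | neg φ ih =>
    have hφ' := (Set.subset_insert _ _).trans hφ
    have h := ih hφ' hw (hφ' φ.mem_subformulas_self) s hs hws
    rw [DepModel.sat]
    refine (not_congr h).trans ?_
    rw [hws]
    simp only [DepModel.type, Set.mem_ofPred_eq, DepModel.sat, hC,
      hφ' φ.mem_subformulas_self, true_and]
  | and φ ψ ih ih' =>
    have h := (Set.subset_insert _ _).trans hφ
    have h1 := Set.subset_union_left.trans h
    have h2 := Set.subset_union_right.trans h
    have hl := ih h1 hw (h1 φ.mem_subformulas_self) s hs hws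
    have hr := ih' h2 hw (h2 ψ.mem_subformulas_self) s hs hws
    rw [DepModel.sat]
    refine (and_congr hl hr).trans ?_
    rw [hws]
    simp only [DepModel.type, Set.mem_ofPred_eq, DepModel.sat, hC,
      h1 φ.mem_subformulas_self, h2 ψ.mem_subformulas_self, true_and]
  | dmod X φ ih =>
    have hφ' := (Set.subset_insert _ _).trans hφ
    have hφC := hφ' φ.mem_subformulas_self
    rw [DepModel.sat]
    constructor
    · intro h
      rw [hws]
      refine ⟨hC, ?_⟩
      rw [DepModel.sat]
      intro s' hs' ha
      obtain ⟨z, hwz, hz, -⟩ := exists_conn_typ_eq hG hs hs' hws ha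
      have hwz' := hwz.mono (Set.empty_subset _)
      have := (ih hφ' (hw.trans hwz') hφC s' hs' hz).1
        (h _ ⟨z, hw.trans hwz', rfl⟩ ((agree_assign_iff hex hwz').2 hwz))
      rw [hz] at this
      exact this.2
    · rintro h _ ⟨z, hz, rfl⟩ ha
      obtain ⟨s', hs', hzs'⟩ := (G.typ z).2
      have hwz := (agree_assign_iff hex (hw.symm.trans hz)).1 ha
      rw [Conn.mem_typ_iff hG (M.localOn_dmod X φ) hwz, hzs'] at h
      refine (ih hφ' hz hφC s' hs' hzs').2 ?_
      rw [hzs']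
      have h2 := h.2
      rw [DepModel.sat] at h2
      exact ⟨hφC, h2 s' hs' fun _ _ => rfl⟩
  | dep X y =>
    rw [DepModel.sat]
    constructor
    · intro h
      rw [hws]
      refine ⟨hC, ?_⟩
      rw [DepModel.sat]
      by_contra! hd
      obtain ⟨s', hs', ha, hne⟩ := hd
      obtain ⟨z, hwz, -, hn⟩ := exists_conn_typ_eq hG hs hs' hws ha
      have hwz' := hwz.mono (Set.empty_subset _)
      refine hn y (fun hl => hne (hl s' hs' ha)) (assign_eq_iff.1 (h _ ⟨z, hw.trans hwz', rfl⟩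
        ((agree_assign_iff hex hwz').2 hwz))).2
    · rintro h _ ⟨z, hz, rfl⟩ ha
      exact assign_eq_iff.2 ⟨rfl,
        ((agree_assign_iff hex (hw.symm.trans hz)).1 ha).of_dep_mem_typ hG h⟩

end Truth

end LGraph

/-- finite model property for LFD — every satisfiable LFD formula
(over a finite set of variables) is satisfiable in a dependence model with finite
domain and finite team. -/
theorem lfd_finite_model_property [Finite V] (φ : LFD V P ar)
    (hsat : ∃ M : DepModel V P ar, ∃ s ∈ M.A, M.sat s φ) :
    ∃ M : DepModel V P ar, ∃ s ∈ M.A, M.sat s φ ∧ Finite M.O ∧ M.A.Finite := by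
  obtain ⟨M, s, hs, hφ⟩ := hsat
  have := DepModel.finite_types (M := M) φ.finite_subformulas
  obtain ⟨G, hG, hex⟩ := LGraph.exists_realizes_exact (M.Step φ.subformulas)
  obtain ⟨w₀, hw₀⟩ := hG.typ_surjective ⟨_, s, hs, rfl⟩
  have := hG.finite_W
  refine ⟨G.model Subtype.val w₀, G.assign w₀, ⟨w₀, .refl _, rfl⟩, ?_,
    inferInstanceAs (Finite (V × Set G.W)), ?_⟩
  · rw [LGraph.sat_model_iff hG hex w₀ φ subset_rfl (.refl _), hw₀]
    exact ⟨φ.mem_subformulas_self, hφ⟩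
  · refine (Set.finite_range G.assign).subset ?_
    rintro _ ⟨w, -, rfl⟩
    exact ⟨w, rfl⟩
end
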